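/- Let K > 0, let R be a closed subset of [0, K] containing 0 and K, and let G : [0, K] → ℝ be Lipschitz continuous and affine on the closure of every connected component of [0, K] ∖ R. Let u : ℝ × (0, ∞) → [0, K] be an entropy solution of ∂_t u + ∂_x G(u) = 0 such that for every bounded interval I ⊂ ℝ, ∫_I |u(x, t) − u₀(x)| dx → 0 as t → 0⁺, where u₀ : ℝ → [0, K] is measurable and u₀(x) ∈ R for almost every x ∈ ℝ. Then u(x, t) ∈ R for almost every (x, t) ∈ ℝ × (0, ∞). -/

import Mathlib

open MeasureTheory Set Filter

/-- Kružkov entropy solution of `∂ₜ u + ∂ₓ G(u) = 0` on `ℝ × (0, ∞)`, with Kružkov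
constants `c` in `[0, K]`. -/
def IsEntropySolution (K : ℝ) (G : ℝ → ℝ) (u : ℝ → ℝ → ℝ) : Prop :=
  ∀ c ∈ Set.Icc (0 : ℝ) K, ∀ φ : ℝ → ℝ → ℝ,
    ContDiff ℝ (⊤ : ℕ∞) (fun p : ℝ × ℝ => φ p.1 p.2) →
    HasCompactSupport (fun p : ℝ × ℝ => φ p.1 p.2) →
    (∀ x t : ℝ, t ≤ 0 → φ x t = 0) →
    (∀ x t : ℝ, 0 ≤ φ x t) →
    0 ≤ ∫ t in Set.Ioi (0 : ℝ), ∫ x : ℝ,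
      (|u x t - c| * deriv (fun s => φ x s) t +
        Real.sign (u x t - c) * (G (u x t) - G c) * deriv (fun y => φ y t) x)

/-- `G` is affine on the closure of every connected component of `[0, K] ∖ R`. -/
def AffineOnGaps (R : Set ℝ) (G : ℝ → ℝ) : Prop :=
  ∀ a b : ℝ, a ∈ R → b ∈ R → a < b → Set.Ioo a b ∩ R = ∅ →
    ∃ m q : ℝ, ∀ x ∈ Set.Icc a b, G x = m * x + q

open scoped Topology ContDiff

theorem tendsto_integral_abs_translate_sub {F : ℝ × ℝ → ℝ} (hF : Integrable F) :
    Tendsto (fun z => ∫ p, |F (p + z) - F p|) (𝓝 0) (𝓝 0) := by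
  let f : Lp ℝ 1 (volume : Measure (ℝ × ℝ)) := hF.toL1 F
  have hf : f =ᵐ[volume] F := hF.coeFn_toL1
  have hcont : Continuous fun z : ℝ × ℝ => ‖(DomAddAct.mk z +ᵥ f) - f‖ := by
    have : Fact ((1 : ENNReal) ≠ ⊤) := ⟨ENNReal.one_ne_top⟩
    have h : Continuous fun z : ℝ × ℝ => DomAddAct.mk z := DomAddAct.continuous_mk
    exact ((h.vadd continuous_const).sub continuous_const).norm
  have h0 := hcont.tendsto 0
  have hz : ‖(DomAddAct.mk (0 : ℝ × ℝ) +ᵥ f) - f‖ = 0 := by simp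
  rw [hz] at h0
  refine h0.congr fun z => ?_
  rw [L1.norm_eq_integral_norm]
  have hmp : MeasurePreserving (fun p : ℝ × ℝ => z + p) := measurePreserving_add_left volume z
  have h1 : (DomAddAct.mk z +ᵥ f : Lp ℝ 1 volume) =ᵐ[volume] f ∘ (fun p => z + p) :=
    Lp.coeFn_compMeasurePreserving f hmp
  have h2 : f ∘ (fun p => z + p) =ᵐ[volume] F ∘ (fun p => z + p) :=
    hmp.quasiMeasurePreserving.ae_eq_comp hf
  apply integral_congr_ae
  filter_upwards [Lp.coeFn_sub (DomAddAct.mk z +ᵥ f) f, h1, h2, hf] with p a b c d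
  rw [a, Pi.sub_apply, b, c, d, Real.norm_eq_abs, Function.comp_apply, add_comm]

theorem integrable_mul_of_hasCompactSupport {g h : ℝ × ℝ → ℝ} {C : ℝ} (hg : Measurable g)
    (hgC : ∀ p, |g p| ≤ C) (hh : Continuous h) (hc : HasCompactSupport h) :
    Integrable fun p => g p * h p :=
  (hh.integrable_of_hasCompactSupport hc).bdd_mul hg.aestronglyMeasurable
    (Eventually.of_forall hgC)

theorem tendsto_integral_abs_translate_sub_mul {U ψ : ℝ × ℝ → ℝ} {C : ℝ} (hU : Measurable U)
    (hUC : ∀ p, |U p| ≤ C) (hψ : Continuous ψ) (hc : HasCompactSupport ψ) :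
    Tendsto (fun z => ∫ p, |U (p + z) - U p| * |ψ p|) (𝓝 0) (𝓝 0) := by
  obtain ⟨D, hD⟩ := hψ.bounded_above_of_compact_support hc
  obtain ⟨r, hr⟩ := hc.isCompact.isBounded.subset_closedBall 0
  set B : Set (ℝ × ℝ) := Metric.closedBall 0 (r + 1)
  have hF : Integrable (B.indicator U) := by
    rw [integrable_indicator_iff Metric.isClosed_closedBall.measurableSet]
    exact Measure.integrableOn_of_bounded (M := C)
      (isCompact_closedBall (0 : ℝ × ℝ) (r + 1)).measure_lt_top.ne hU.aestronglyMeasurable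
      (Eventually.of_forall hUC)
  have hlim := (tendsto_integral_abs_translate_sub hF).mul_const D
  rw [zero_mul] at hlim
  refine squeeze_zero' (Eventually.of_forall fun z => by positivity) ?_ hlim
  filter_upwards [Metric.ball_mem_nhds (0 : ℝ × ℝ) one_pos] with z hz
  rw [← integral_mul_const]
  refine integral_mono_of_nonneg (Eventually.of_forall fun p => by positivity) ?_
    (Eventually.of_forall fun p => ?_)
  · exact (((hF.comp_add_right z).sub hF).abs.mul_const D)
  · by_cases hp : ψ p = 0
    · simp only [hp, abs_zero, mul_zero]
      exact mul_nonneg (abs_nonneg _) ((norm_nonneg _).trans (hD 0))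
    · have hpr : ‖p‖ ≤ r := by simpa using hr (subset_tsupport _ hp)
      have hz' : ‖z‖ < 1 := by simpa using hz
      have h1 : p ∈ B := by simp [B]; linarith
      have h2 : p + z ∈ B := by simp [B]; linarith [norm_add_le p z]
      simp only [indicator_of_mem h1, indicator_of_mem h2]
      exact mul_le_mul_of_nonneg_left (hD p) (abs_nonneg _)

/-- Nonnegative smooth compactly supported functions on `ℝ × ℝ` that vanish for `t ≤ 0`. -/
structure IsTestFunction (f : ℝ × ℝ → ℝ) : Prop where
  contDiff : ContDiff ℝ ∞ f
  hasCompactSupport : HasCompactSupport f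
  eq_zero : ∀ p, p.2 ≤ 0 → f p = 0
  nonneg : ∀ p, 0 ≤ f p

/-- `∂ₜ η(U) + ∂ₓ q(U) ≤ 0` in the sense of distributions on `ℝ × (0, ∞)`. -/
def IsEntropyFluxPair (U : ℝ × ℝ → ℝ) (η q : ℝ → ℝ) : Prop :=
  ∀ f, IsTestFunction f →
    0 ≤ ∫ p, (η (U p) * fderiv ℝ f p (0, 1) + q (U p) * fderiv ℝ f p (1, 0))

namespace IsTestFunction

variable {f : ℝ × ℝ → ℝ}

theorem fderiv_eq_zero (hf : IsTestFunction f) {p : ℝ × ℝ} (hp : p.2 ≤ 0) : fderiv ℝ f p = 0 := by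
  refine IsLocalMin.fderiv_eq_zero (Eventually.of_forall fun r => ?_)
  rw [hf.eq_zero p hp]
  exact hf.nonneg r

end IsTestFunction

theorem continuous_fderiv_apply_const {f : ℝ × ℝ → ℝ} (hf : ContDiff ℝ ∞ f) (e : ℝ × ℝ) :
    Continuous fun p => fderiv ℝ f p e :=
  (hf.continuous_fderiv (by simp)).clm_apply continuous_const

theorem hasCompactSupport_fderiv_apply_const {f : ℝ × ℝ → ℝ} (hc : HasCompactSupport f)
    (e : ℝ × ℝ) : HasCompactSupport fun p => fderiv ℝ f p e :=
  hc.fderiv_apply (𝕜 := ℝ) e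

theorem exists_abs_comp_le {U : ℝ × ℝ → ℝ} {K : ℝ} (hU : ∀ p, U p ∈ Icc 0 K) {η : ℝ → ℝ}
    (hη : Continuous η) : ∃ C, ∀ p, |η (U p)| ≤ C := by
  obtain ⟨C, hC⟩ := isCompact_Icc.exists_bound_of_continuousOn (s := Icc 0 K) hη.continuousOn
  exact ⟨C, fun p => hC _ (hU p)⟩

theorem integrable_comp_mul {U h : ℝ × ℝ → ℝ} {K : ℝ} (hUm : Measurable U)
    (hU : ∀ p, U p ∈ Icc 0 K) {η : ℝ → ℝ} (hη : Continuous η) (hh : Continuous h)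
    (hc : HasCompactSupport h) : Integrable fun p => η (U p) * h p := by
  obtain ⟨C, hC⟩ := exists_abs_comp_le hU hη
  exact integrable_mul_of_hasCompactSupport (hη.measurable.comp hUm) hC hh hc

theorem integrable_entropy_integrand {U f : ℝ × ℝ → ℝ} {K : ℝ} (hUm : Measurable U)
    (hU : ∀ p, U p ∈ Icc 0 K) {η q : ℝ → ℝ} (hη : Continuous η) (hq : Continuous q)
    (hf : ContDiff ℝ ∞ f) (hc : HasCompactSupport f) :
    Integrable fun p => η (U p) * fderiv ℝ f p (0, 1) + q (U p) * fderiv ℝ f p (1, 0) :=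
  (integrable_comp_mul hUm hU hη (continuous_fderiv_apply_const hf _)
    (hasCompactSupport_fderiv_apply_const hc _)).add
  (integrable_comp_mul hUm hU hq (continuous_fderiv_apply_const hf _)
    (hasCompactSupport_fderiv_apply_const hc _))

theorem IsEntropyFluxPair.linear_combination {U : ℝ × ℝ → ℝ} {K : ℝ} (hUm : Measurable U)
    (hU : ∀ p, U p ∈ Icc 0 K) {η₁ q₁ η₂ q₂ : ℝ → ℝ} (hη₁ : Continuous η₁) (hq₁ : Continuous q₁)
    (hη₂ : Continuous η₂) (hq₂ : Continuous q₂) (h₁ : IsEntropyFluxPair U η₁ q₁)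
    (h₂ : IsEntropyFluxPair U η₂ q₂) {α β : ℝ} (hα : 0 ≤ α) (hβ : 0 ≤ β) :
    IsEntropyFluxPair U (fun v => α * η₁ v + β * η₂ v) (fun v => α * q₁ v + β * q₂ v) := by
  intro f hf
  have i₁ := integrable_entropy_integrand hUm hU hη₁ hq₁ hf.contDiff hf.hasCompactSupport
  have i₂ := integrable_entropy_integrand hUm hU hη₂ hq₂ hf.contDiff hf.hasCompactSupport
  have h := add_nonneg (mul_nonneg hα (h₁ f hf)) (mul_nonneg hβ (h₂ f hf))
  rw [← integral_const_mul, ← integral_const_mul,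
    ← integral_add (i₁.const_mul α) (i₂.const_mul β)] at h
  refine h.trans_eq (integral_congr_ae (Eventually.of_forall fun p => ?_))
  simp only
  ring

theorem integrable_mul_mul_comp_sub {g : (ℝ × ℝ) × (ℝ × ℝ) → ℝ} {C : ℝ} (hg : Measurable g)
    (hgC : ∀ w, |g w| ≤ C) {a b : ℝ × ℝ → ℝ} (ha : Continuous a) (hac : HasCompactSupport a)
    (hb : Continuous b) (hbc : HasCompactSupport b) :
    Integrable (fun w : (ℝ × ℝ) × (ℝ × ℝ) => g w * (a w.1 * b (w.2 - w.1)))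
      (volume.prod volume) := by
  have h := ((ha.integrable_of_hasCompactSupport hac (μ := volume)).convolution_integrand
    (ContinuousLinearMap.mul ℝ ℝ) (hb.integrable_of_hasCompactSupport hbc (μ := volume))).swap
  exact h.bdd_mul hg.aestronglyMeasurable (Eventually.of_forall hgC)

theorem fderiv_mul_comp_const_sub {φ ρ : ℝ × ℝ → ℝ} (hφ : ContDiff ℝ ∞ φ) (hρ : ContDiff ℝ ∞ ρ)
    (r p e : ℝ × ℝ) : fderiv ℝ (fun p => φ p * ρ (r - p)) p e =
      fderiv ℝ φ p e * ρ (r - p) - φ p * fderiv ℝ ρ (r - p) e := by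
  have h1 := (hφ.differentiable (by simp) p).hasFDerivAt
  have h2 : HasFDerivAt (fun p => ρ (r - p)) ((fderiv ℝ ρ (r - p)).comp (-(.id ℝ (ℝ × ℝ)))) p :=
    (hρ.differentiable (by simp) (r - p)).hasFDerivAt.comp p ((hasFDerivAt_id p).const_sub r)
  rw [(h1.fun_mul h2).fderiv]
  simp
  ring

theorem fderiv_const_mul_comp_sub_const {ρ : ℝ × ℝ → ℝ} (hρ : ContDiff ℝ ∞ ρ) (c : ℝ)
    (r p e : ℝ × ℝ) : fderiv ℝ (fun r => c * ρ (r - p)) r e = c * fderiv ℝ ρ (r - p) e := by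
  have h2 : HasFDerivAt (fun r => ρ (r - p)) ((fderiv ℝ ρ (r - p)).comp (.id ℝ (ℝ × ℝ))) r :=
    (hρ.differentiable (by simp) (r - p)).hasFDerivAt.comp r ((hasFDerivAt_id r).sub_const p)
  rw [(h2.const_mul c).fderiv]
  simp

section Doubling

variable {U : ℝ × ℝ → ℝ} {K : ℝ} {S Q : ℝ → ℝ → ℝ} {φ : ℝ × ℝ → ℝ} {δ : ℝ}

theorem exists_abs_comp₂_le (hU : ∀ p, U p ∈ Icc 0 K)
    (hS : Continuous fun w : ℝ × ℝ => S w.1 w.2) : ∃ C, ∀ p r, |S (U p) (U r)| ≤ C := by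
  obtain ⟨C, hC⟩ := (isCompact_Icc.prod isCompact_Icc).exists_bound_of_continuousOn
    (s := Icc 0 K ×ˢ Icc 0 K) hS.continuousOn
  exact ⟨C, fun p r => hC (U p, U r) ⟨hU p, hU r⟩⟩

theorem doubling_mollified (hUm : Measurable U) (hU : ∀ p, U p ∈ Icc 0 K)
    (hS : Continuous fun w : ℝ × ℝ => S w.1 w.2) (hQ : Continuous fun w : ℝ × ℝ => Q w.1 w.2)
    (hSsymm : ∀ v w, S v w = S w v) (hQsymm : ∀ v w, Q v w = Q w v)
    (h : ∀ v ∈ Icc 0 K, IsEntropyFluxPair U (fun w => S w v) (fun w => Q w v))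
    (hφ : IsTestFunction φ) (hφδ : ∀ p, p.2 ≤ δ → φ p = 0) {ρ : ℝ × ℝ → ℝ}
    (hρ : ContDiff ℝ ∞ ρ) (hρc : HasCompactSupport ρ) (hρ0 : ∀ z, 0 ≤ ρ z)
    (hρδ : ∀ z, z.2 ≤ -δ → ρ z = 0) :
    Integrable (fun z => ρ z * ∫ p, (S (U p) (U (p + z)) * fderiv ℝ φ p (0, 1) +
      Q (U p) (U (p + z)) * fderiv ℝ φ p (1, 0))) ∧
    0 ≤ ∫ z, ρ z * ∫ p, (S (U p) (U (p + z)) * fderiv ℝ φ p (0, 1) +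
      Q (U p) (U (p + z)) * fderiv ℝ φ p (1, 0)) := by
  obtain ⟨CS, hCS⟩ := exists_abs_comp₂_le hU hS
  obtain ⟨CQ, hCQ⟩ := exists_abs_comp₂_le hU hQ
  have hSm : Measurable fun w : (ℝ × ℝ) × (ℝ × ℝ) => S (U w.1) (U w.2) :=
    hS.measurable.comp ((hUm.comp measurable_fst).prodMk (hUm.comp measurable_snd))
  have hQm : Measurable fun w : (ℝ × ℝ) × (ℝ × ℝ) => Q (U w.1) (U w.2) :=
    hQ.measurable.comp ((hUm.comp measurable_fst).prodMk (hUm.comp measurable_snd))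
  have hφd := continuous_fderiv_apply_const hφ.contDiff
  have hφdc := hasCompactSupport_fderiv_apply_const hφ.hasCompactSupport
  have hρd := continuous_fderiv_apply_const hρ
  have hρdc := hasCompactSupport_fderiv_apply_const hρc
  let I₁ : (ℝ × ℝ) × (ℝ × ℝ) → ℝ := fun w =>
    S (U w.1) (U w.2) * fderiv ℝ (fun p => φ p * ρ (w.2 - p)) w.1 (0, 1) +
      Q (U w.1) (U w.2) * fderiv ℝ (fun p => φ p * ρ (w.2 - p)) w.1 (1, 0)
  let I₂ : (ℝ × ℝ) × (ℝ × ℝ) → ℝ := fun w =>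
    S (U w.1) (U w.2) * fderiv ℝ (fun r => φ w.1 * ρ (r - w.1)) w.2 (0, 1) +
      Q (U w.1) (U w.2) * fderiv ℝ (fun r => φ w.1 * ρ (r - w.1)) w.2 (1, 0)
  have hI₁ : Integrable I₁ (volume.prod volume) := by
    simp only [I₁, fderiv_mul_comp_const_sub hφ.contDiff hρ, mul_sub]
    refine Integrable.add (Integrable.sub ?_ ?_) (Integrable.sub ?_ ?_)
    · exact integrable_mul_mul_comp_sub hSm (fun w => hCS _ _) (hφd _) (hφdc _) hρ.continuous hρc
    · exact integrable_mul_mul_comp_sub hSm (fun w => hCS _ _) hφ.contDiff.continuous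
        hφ.hasCompactSupport (hρd _) (hρdc _)
    · exact integrable_mul_mul_comp_sub hQm (fun w => hCQ _ _) (hφd _) (hφdc _) hρ.continuous hρc
    · exact integrable_mul_mul_comp_sub hQm (fun w => hCQ _ _) hφ.contDiff.continuous
        hφ.hasCompactSupport (hρd _) (hρdc _)
  have hI₂ : Integrable I₂ (volume.prod volume) := by
    simp only [I₂, fderiv_const_mul_comp_sub_const hρ]
    refine Integrable.add ?_ ?_
    · exact integrable_mul_mul_comp_sub hSm (fun w => hCS _ _) hφ.contDiff.continuous
        hφ.hasCompactSupport (hρd _) (hρdc _)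
    · exact integrable_mul_mul_comp_sub hQm (fun w => hCQ _ _) hφ.contDiff.continuous
        hφ.hasCompactSupport (hρd _) (hρdc _)
  have hvanish : ∀ p r : ℝ × ℝ, r.2 ≤ 0 → φ p * ρ (r - p) = 0 := by
    intro p r hr
    rcases le_or_gt p.2 δ with hp | hp
    · rw [hφδ p hp, zero_mul]
    · rw [hρδ (r - p) (by simp; linarith), mul_zero]
  have h₁ : ∀ r, 0 ≤ ∫ p, I₁ (p, r) := fun r => by
    refine h (U r) (hU r) (fun p => φ p * ρ (r - p)) ⟨?_, ?_, ?_, ?_⟩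
    · exact hφ.contDiff.mul (hρ.comp (contDiff_const.sub contDiff_id))
    · exact hφ.hasCompactSupport.mul_right
    · intro p hp
      simp only [hφ.eq_zero p hp, zero_mul]
    · exact fun p => mul_nonneg (hφ.nonneg _) (hρ0 _)
  have h₂ : ∀ p, 0 ≤ ∫ r, I₂ (p, r) := fun p => by
    simp only [I₂, hSsymm (U p), hQsymm (U p)]
    refine h (U p) (hU p) (fun r => φ p * ρ (r - p)) ⟨?_, ?_, ?_, ?_⟩
    · exact contDiff_const.mul (hρ.comp (contDiff_id.sub contDiff_const))
    · exact (hρc.comp_homeomorph (Homeomorph.subRight p)).mul_left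
    · exact fun r hr => hvanish p r hr
    · exact fun p => mul_nonneg (hφ.nonneg _) (hρ0 _)
  have hsum : 0 ≤ ∫ w, (I₁ + I₂) w ∂(volume.prod volume) := by
    simp only [Pi.add_apply]
    rw [integral_add hI₁ hI₂, integral_prod_symm _ hI₁, integral_prod _ hI₂]
    exact add_nonneg (integral_nonneg h₁) (integral_nonneg h₂)
  have hI : ∀ p r, (I₁ + I₂) (p, r) = ρ (r - p) * (S (U p) (U r) * fderiv ℝ φ p (0, 1) +
      Q (U p) (U r) * fderiv ℝ φ p (1, 0)) := by
    intro p r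
    simp only [I₁, I₂, Pi.add_apply, fderiv_mul_comp_const_sub hφ.contDiff hρ,
      fderiv_const_mul_comp_sub_const hρ]
    ring
  let J : (ℝ × ℝ) × (ℝ × ℝ) → ℝ := fun w => ρ w.2 *
    (S (U w.1) (U (w.1 + w.2)) * fderiv ℝ φ w.1 (0, 1) +
      Q (U w.1) (U (w.1 + w.2)) * fderiv ℝ φ w.1 (1, 0))
  have hJ : Integrable J (volume.prod volume) := by
    have := (measurePreserving_prod_add (volume : Measure (ℝ × ℝ))
      (volume : Measure (ℝ × ℝ))).integrable_comp_of_integrable (hI₁.add hI₂)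
    refine this.congr (Eventually.of_forall fun w => ?_)
    simp only [Function.comp_apply, hI, J, add_sub_cancel_left]
  have hJ0 : 0 ≤ ∫ w, J w ∂(volume.prod volume) := by
    rw [integral_prod _ (hI₁.add hI₂)] at hsum
    rw [integral_prod _ hJ]
    refine hsum.trans_eq (integral_congr_ae (Eventually.of_forall fun p => ?_))
    simp only [hI, J]
    rw [← integral_add_left_eq_self _ p]
    simp only [add_sub_cancel_left]
  have hJint := hJ.integral_prod_right
  rw [integral_prod_symm _ hJ] at hJ0
  simp only [J, integral_const_mul] at hJint hJ0
  exact ⟨hJint, hJ0⟩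

theorem doubling (hUm : Measurable U) (hU : ∀ p, U p ∈ Icc 0 K)
    (hS : Continuous fun w : ℝ × ℝ => S w.1 w.2) (hQ : Continuous fun w : ℝ × ℝ => Q w.1 w.2)
    (hSsymm : ∀ v w, S v w = S w v) (hQsymm : ∀ v w, Q v w = Q w v) {C : ℝ}
    (hSlip : ∀ u v w, |S u v - S u w| ≤ C * |v - w|)
    (hQlip : ∀ u v w, |Q u v - Q u w| ≤ C * |v - w|)
    (h : ∀ v ∈ Icc 0 K, IsEntropyFluxPair U (fun w => S w v) (fun w => Q w v))
    (hφ : IsTestFunction φ) (hδ : 0 < δ) (hφδ : ∀ p, p.2 ≤ δ → φ p = 0) :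
    0 ≤ ∫ p, (S (U p) (U p) * fderiv ℝ φ p (0, 1) + Q (U p) (U p) * fderiv ℝ φ p (1, 0)) := by
  have hφd := continuous_fderiv_apply_const hφ.contDiff
  have hφdc := hasCompactSupport_fderiv_apply_const hφ.hasCompactSupport
  obtain ⟨CS, hCS⟩ := exists_abs_comp₂_le hU hS
  obtain ⟨CQ, hCQ⟩ := exists_abs_comp₂_le hU hQ
  let H : ℝ × ℝ → ℝ := fun z => ∫ p, (S (U p) (U (p + z)) * fderiv ℝ φ p (0, 1) +
    Q (U p) (U (p + z)) * fderiv ℝ φ p (1, 0))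
  have hInt : ∀ z, Integrable fun p => (S (U p) (U (p + z)) * fderiv ℝ φ p (0, 1) +
      Q (U p) (U (p + z)) * fderiv ℝ φ p (1, 0)) := fun z => by
    have hm : Measurable fun p => (U p, U (p + z)) :=
      hUm.prodMk (hUm.comp (measurable_id.add_const z))
    exact (integrable_mul_of_hasCompactSupport (hS.measurable.comp hm) (fun p => hCS _ _)
      (hφd _) (hφdc _)).add (integrable_mul_of_hasCompactSupport (hQ.measurable.comp hm)
      (fun p => hCQ _ _) (hφd _) (hφdc _))
  have hUK : ∀ p, |U p| ≤ K := fun p => by rw [abs_of_nonneg (hU p).1]; exact (hU p).2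
  have hH : Tendsto H (𝓝 0) (𝓝 (H 0)) := by
    have hlim := ((tendsto_integral_abs_translate_sub_mul hUm hUK (hφd (0, 1)) (hφdc _)).add
      (tendsto_integral_abs_translate_sub_mul hUm hUK (hφd (1, 0)) (hφdc _))).const_mul C
    rw [add_zero, mul_zero] at hlim
    rw [tendsto_iff_norm_sub_tendsto_zero]
    refine squeeze_zero (fun _ => norm_nonneg _) (fun z => ?_) hlim
    have hi : ∀ e : ℝ × ℝ, Integrable fun p => |U (p + z) - U p| * |fderiv ℝ φ p e| := fun e =>
      integrable_mul_of_hasCompactSupport (C := K + K)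
        (((hUm.comp (measurable_id.add_const z)).sub hUm).norm)
        (fun p => by rw [abs_abs]; exact (abs_sub _ _).trans (add_le_add (hUK _) (hUK _)))
        (hφd e).abs (hφdc e).abs
    rw [← integral_add (hi _) (hi _), ← integral_const_mul, ← integral_sub (hInt z) (hInt 0)]
    refine norm_integral_le_of_norm_le (((hi _).add (hi _)).const_mul C)
      (Eventually.of_forall fun p => ?_)
    have e1 := mul_le_mul_of_nonneg_right (hSlip (U p) (U (p + z)) (U p))
      (abs_nonneg (fderiv ℝ φ p (0, 1)))
    have e2 := mul_le_mul_of_nonneg_right (hQlip (U p) (U (p + z)) (U p))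
      (abs_nonneg (fderiv ℝ φ p (1, 0)))
    rw [← abs_mul] at e1 e2
    have e3 := abs_add_le
      ((S (U p) (U (p + z)) - S (U p) (U p)) * fderiv ℝ φ p (0, 1))
      ((Q (U p) (U (p + z)) - Q (U p) (U p)) * fderiv ℝ φ p (1, 0))
    rw [Real.norm_eq_abs, add_zero]
    refine le_trans (le_of_eq (congrArg _ ?_)) (e3.trans ((add_le_add e1 e2).trans_eq ?_))
    · ring
    · ring
  have hgoal : 0 ≤ H 0 := by
    by_contra! hneg
    obtain ⟨ε, hε, hεH⟩ := Metric.eventually_nhds_iff.1 (hH.eventually_lt_const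
      (show H 0 < H 0 / 2 by linarith))
    have hm : 0 < min ε δ := lt_min hε hδ
    let ρ : ContDiffBump (0 : ℝ × ℝ) := ⟨min ε δ / 2, min ε δ, by linarith, by linarith⟩
    have hρ0 : ∀ z : ℝ × ℝ, min ε δ ≤ ‖z‖ → ρ z = 0 := fun z hz =>
      ρ.zero_of_le_dist (by rw [dist_zero_right]; exact hz)
    obtain ⟨hi, hn⟩ := doubling_mollified hUm hU hS hQ hSsymm hQsymm h hφ hφδ (ρ := ρ)
      ρ.contDiff ρ.hasCompactSupport (fun z => ρ.nonneg) (fun z hz => hρ0 z (by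
        have h1 : |z.2| ≤ ‖z‖ := norm_snd_le z
        have h2 := neg_le_abs z.2
        have h3 := min_le_right ε δ
        linarith))
    have hle : ∫ z, ρ z * H z ≤ ∫ z, ρ z * (H 0 / 2) := by
      refine integral_mono hi (ρ.integrable.mul_const _) fun z => ?_
      rcases lt_or_ge ‖z‖ (min ε δ) with hz | hz
      · exact mul_le_mul_of_nonneg_left
          (hεH (by simpa using hz.trans_le (min_le_left _ _))).le ρ.nonneg
      · simp [hρ0 z hz]
    rw [integral_mul_const] at hle
    have hpos : 0 < ∫ z, ρ z := ρ.integral_pos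
    have : (∫ z, ρ z) * (H 0 / 2) < 0 := mul_neg_of_pos_of_neg hpos (by linarith)
    exact absurd (hn.trans hle) (not_le.2 this)
  simpa only [H, add_zero] using hgoal

end Doubling

theorem sign_mul_sub_eq (G : ℝ → ℝ) (v c : ℝ) :
    Real.sign (v - c) * (G v - G c) = G (max v c) - G (min v c) := by
  rcases lt_trichotomy v c with h | rfl | h
  · rw [Real.sign_of_neg (sub_neg.2 h), max_eq_right h.le, min_eq_left h.le]
    ring
  · simp
  · rw [Real.sign_of_pos (sub_pos.2 h), max_eq_left h.le, min_eq_right h.le]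
    ring

theorem IsEntropySolution.isEntropyFluxPair {K : ℝ} {G : ℝ → ℝ} (hG : Continuous G)
    {u : ℝ → ℝ → ℝ} (hmeas : Measurable fun p : ℝ × ℝ => u p.1 p.2)
    (hrange : ∀ x t : ℝ, u x t ∈ Icc 0 K) (hent : IsEntropySolution K G u) {c : ℝ}
    (hc : c ∈ Icc 0 K) : IsEntropyFluxPair (fun p => u p.1 p.2) (fun v => |v - c|)
      (fun v => G (max v c) - G (min v c)) := by
  intro f hf
  have h := hent c hc (fun x t => f (x, t)) hf.contDiff hf.hasCompactSupport
    (fun x t ht => hf.eq_zero (x, t) ht) (fun x t => hf.nonneg (x, t))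
  have hd : ∀ p, HasFDerivAt f (fderiv ℝ f p) p := fun p =>
    (hf.contDiff.differentiable (by simp) p).hasFDerivAt
  have h1 : ∀ x t, deriv (fun s => f (x, s)) t = fderiv ℝ f (x, t) (0, 1) := fun x t =>
    ((hd (x, t)).comp_hasDerivAt t ((hasDerivAt_const t x).prodMk (hasDerivAt_id t))).deriv
  have h2 : ∀ x t, deriv (fun y => f (y, t)) x = fderiv ℝ f (x, t) (1, 0) := fun x t =>
    ((hd (x, t)).comp_hasDerivAt x ((hasDerivAt_id x).prodMk (hasDerivAt_const x t))).deriv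
  have hInt := integrable_entropy_integrand hmeas (fun p => hrange p.1 p.2)
    (η := fun v => |v - c|) (q := fun v => G (max v c) - G (min v c)) (by fun_prop) (by fun_prop)
    hf.contDiff hf.hasCompactSupport
  simp only [h1, h2, sign_mul_sub_eq] at h
  rw [setIntegral_eq_integral_of_forall_compl_eq_zero] at h
  · exact h.trans_eq (integral_prod_symm _ hInt).symm
  · intro t ht
    have ht' : t ≤ 0 := not_lt.1 ht
    simp [hf.fderiv_eq_zero (show ((_, t) : ℝ × ℝ).2 ≤ 0 from ht')]

section Gap

/-- The Green function of `-(b - a) ∂²` on `[a, b]` with Dirichlet boundary conditions, extended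
by zero. -/
def gapKernel (a b v w : ℝ) : ℝ :=
  (min (max a (min b v)) (max a (min b w)) - a) * (b - max (max a (min b v)) (max a (min b w)))

/-- The entropy `(b - a) |v - w| + 2 gapKernel a b v w`, symmetric in `v` and `w` and convex in
each variable. -/
def gapEntropy (a b v w : ℝ) : ℝ := (b - a) * |v - w| + 2 * gapKernel a b v w

/-- The flux of `gapEntropy` when the flux function `G` has slope `m` on `[a, b]`. -/
def gapFlux (G : ℝ → ℝ) (a b m v w : ℝ) : ℝ :=
  (b - a) * (G (max v w) - G (min v w)) + 2 * m * gapKernel a b v w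

variable {G : ℝ → ℝ} {a b m q : ℝ}

theorem gapKernel_comm (v w : ℝ) : gapKernel a b v w = gapKernel a b w v := by
  simp only [gapKernel, min_comm (max a (min b v)), max_comm (max a (min b v))]

theorem gapEntropy_comm (v w : ℝ) : gapEntropy a b v w = gapEntropy a b w v := by
  rw [gapEntropy, gapEntropy, gapKernel_comm, abs_sub_comm]

theorem gapFlux_comm (v w : ℝ) : gapFlux G a b m v w = gapFlux G a b m w v := by
  rw [gapFlux, gapFlux, gapKernel_comm, max_comm, min_comm]

theorem continuous_gapKernel : Continuous fun w : ℝ × ℝ => gapKernel a b w.1 w.2 := by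
  unfold gapKernel
  fun_prop

theorem continuous_gapEntropy : Continuous fun w : ℝ × ℝ => gapEntropy a b w.1 w.2 := by
  have := continuous_gapKernel (a := a) (b := b)
  unfold gapEntropy
  fun_prop

theorem continuous_gapFlux (hG : Continuous G) :
    Continuous fun w : ℝ × ℝ => gapFlux G a b m w.1 w.2 := by
  have := continuous_gapKernel (a := a) (b := b)
  unfold gapFlux
  fun_prop

theorem abs_gapKernel_sub_le (hab : a < b) (u v w : ℝ) :
    |gapKernel a b u v - gapKernel a b u w| ≤ 2 * (b - a) * |v - w| := by
  have hP : ∀ x, a ≤ max a (min b x) ∧ max a (min b x) ≤ b := fun x =>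
    ⟨le_max_left _ _, max_le hab.le (min_le_left _ _)⟩
  have hlip : |max a (min b v) - max a (min b w)| ≤ |v - w| := by
    refine (abs_max_sub_max_le_max _ _ _ _).trans (max_le (by simp) ?_)
    exact (abs_min_sub_min_le_max _ _ _ _).trans (max_le (by simp) le_rfl)
  unfold gapKernel
  obtain ⟨hr, hr'⟩ := hP u
  obtain ⟨hs, hs'⟩ := hP v
  obtain ⟨ht, ht'⟩ := hP w
  generalize max a (min b u) = r at *
  generalize max a (min b v) = s at *
  generalize max a (min b w) = t at *
  have h1 : |min r s - min r t| ≤ |v - w| :=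
    (abs_min_sub_min_le_max _ _ _ _).trans (max_le (by simp) hlip)
  have h2 : |max r s - max r t| ≤ |v - w| :=
    (abs_max_sub_max_le_max _ _ _ _).trans (max_le (by simp) hlip)
  have e : (min r s - a) * (b - max r s) - (min r t - a) * (b - max r t) =
      (min r s - min r t) * (b - max r s) - (min r t - a) * (max r s - max r t) := by ring
  have h3 : |b - max r s| ≤ b - a := by
    rw [abs_of_nonneg (sub_nonneg.2 (max_le hr' hs'))]
    linarith [le_max_left r s]
  have h4 : |min r t - a| ≤ b - a := by
    rw [abs_of_nonneg (sub_nonneg.2 (le_min hr ht))]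
    linarith [min_le_left r t]
  rw [e]
  refine (abs_sub _ _).trans ?_
  rw [abs_mul, abs_mul]
  have := mul_le_mul h1 h3 (abs_nonneg _) (abs_nonneg _)
  have := mul_le_mul h4 h2 (abs_nonneg _) (sub_nonneg.2 hab.le)
  linarith

theorem abs_gapEntropy_sub_le (hab : a < b) (u v w : ℝ) :
    |gapEntropy a b u v - gapEntropy a b u w| ≤ 5 * (b - a) * |v - w| := by
  have h1 : |(|u - v| - |u - w|)| ≤ |v - w| := by
    refine (abs_abs_sub_abs_le _ _).trans_eq ?_
    rw [sub_sub_sub_cancel_left, abs_sub_comm]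
  have h2 := abs_gapKernel_sub_le hab u v w
  have e : gapEntropy a b u v - gapEntropy a b u w =
      (b - a) * (|u - v| - |u - w|) + 2 * (gapKernel a b u v - gapKernel a b u w) := by
    simp only [gapEntropy]
    ring
  rw [e]
  refine (abs_add_le _ _).trans ?_
  rw [abs_mul, abs_mul, abs_of_pos (sub_pos.2 hab), abs_two]
  linarith [mul_le_mul_of_nonneg_left h1 (sub_pos.2 hab).le]

theorem abs_gapFlux_sub_le {L : NNReal} (hG : LipschitzWith L G) (hab : a < b) (u v w : ℝ) :
    |gapFlux G a b m u v - gapFlux G a b m u w| ≤ (2 * L + 4 * |m|) * (b - a) * |v - w| := by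
  have hL : ∀ x y, |G x - G y| ≤ L * |x - y| := fun x y => by
    simpa [Real.dist_eq] using hG.dist_le_mul x y
  have h1 : |G (max u v) - G (max u w)| ≤ L * |v - w| :=
    (hL _ _).trans (mul_le_mul_of_nonneg_left
      ((abs_max_sub_max_le_max _ _ _ _).trans (max_le (by simp) le_rfl)) L.coe_nonneg)
  have h2 : |G (min u v) - G (min u w)| ≤ L * |v - w| :=
    (hL _ _).trans (mul_le_mul_of_nonneg_left
      ((abs_min_sub_min_le_max _ _ _ _).trans (max_le (by simp) le_rfl)) L.coe_nonneg)
  have h3 := abs_gapKernel_sub_le hab u v w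
  have e : gapFlux G a b m u v - gapFlux G a b m u w =
      (b - a) * ((G (max u v) - G (max u w)) - (G (min u v) - G (min u w))) +
        2 * m * (gapKernel a b u v - gapKernel a b u w) := by
    simp only [gapFlux]
    ring
  rw [e]
  refine (abs_add_le _ _).trans ?_
  rw [abs_mul, abs_mul, abs_of_pos (sub_pos.2 hab), abs_mul, abs_two]
  have h4 := mul_le_mul_of_nonneg_left ((abs_sub _ _).trans (add_le_add h1 h2))
    (sub_pos.2 hab).le
  have h5 := mul_le_mul_of_nonneg_left h3 (mul_nonneg two_pos.le (abs_nonneg m))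
  linarith

theorem gapKernel_self (v : ℝ) :
    gapKernel a b v v = (max a (min b v) - a) * (b - max a (min b v)) := by
  simp [gapKernel]

theorem gapKernel_eq_zero (hab : a < b) {w : ℝ} (hw : w ∉ Icc a b) (v : ℝ) :
    gapKernel a b v w = 0 := by
  unfold gapKernel
  rcases lt_or_ge w a with h | h
  · have : max a (min b w) = a := max_eq_left ((min_le_right _ _).trans h.le)
    rw [this, min_eq_right (le_max_left _ _), sub_self, zero_mul]
  · have hbw : b < w := not_le.1 fun h' => hw ⟨h, h'⟩
    have : max a (min b w) = b := by rw [min_eq_left hbw.le, max_eq_right hab.le]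
    rw [this, max_eq_right (max_le hab.le (min_le_left _ _)), sub_self, mul_zero]

theorem gapEntropy_of_mem {w : ℝ} (hw : w ∈ Icc a b) (v : ℝ) :
    gapEntropy a b v w = (b - w) * |v - a| + (w - a) * |v - b| := by
  obtain ⟨h1, h2⟩ := hw
  rw [gapEntropy, gapKernel, min_eq_right h2, max_eq_right h1]
  rcases le_total v a with h | h
  · rw [abs_of_nonpos (by linarith), abs_of_nonpos (by linarith), abs_of_nonpos (by linarith),
      max_eq_left ((min_le_right _ _).trans h), min_eq_left h1]
    ring
  rcases le_total b v with h' | h'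
  · rw [abs_of_nonneg (by linarith), abs_of_nonneg (by linarith), abs_of_nonneg (by linarith),
      min_eq_left h', max_eq_right (h1.trans h2), max_eq_left h2]
    ring
  rw [min_eq_right h', max_eq_right h, abs_of_nonneg (sub_nonneg.2 h),
    abs_of_nonpos (sub_nonpos.2 h')]
  rcases le_total v w with h3 | h3
  · rw [abs_of_nonpos (sub_nonpos.2 h3), min_eq_left h3, max_eq_right h3]
    ring
  · rw [abs_of_nonneg (sub_nonneg.2 h3), min_eq_right h3, max_eq_left h3]
    ring

theorem gapFlux_of_mem (haff : ∀ x ∈ Icc a b, G x = m * x + q) {w : ℝ} (hw : w ∈ Icc a b)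
    (v : ℝ) : gapFlux G a b m v w =
      (b - w) * (G (max v a) - G (min v a)) + (w - a) * (G (max v b) - G (min v b)) := by
  obtain ⟨h1, h2⟩ := id hw
  have hGa := haff a ⟨le_rfl, h1.trans h2⟩
  have hGb := haff b ⟨h1.trans h2, le_rfl⟩
  have hGw := haff w hw
  rw [gapFlux, gapKernel, min_eq_right h2, max_eq_right h1]
  rcases le_total v a with h | h
  · rw [max_eq_left ((min_le_right _ _).trans h), min_eq_left h1, max_eq_right h, min_eq_left h,
      max_eq_right (h.trans h1), min_eq_left (h.trans h1), max_eq_right (h.trans (h1.trans h2)),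
      min_eq_left (h.trans (h1.trans h2)), hGa, hGb, hGw]
    ring
  rcases le_total b v with h' | h'
  · rw [min_eq_left h', max_eq_right (h1.trans h2), max_eq_left h2, max_eq_left h', max_eq_left h,
      min_eq_right h', min_eq_right h, max_eq_left (h2.trans h'), min_eq_right (h2.trans h'),
      hGa, hGb, hGw]
    ring
  have hGv := haff v ⟨h, h'⟩
  rw [min_eq_right h', max_eq_right h, max_eq_left h, min_eq_right h, max_eq_right h',
    min_eq_left h', hGa, hGb]
  rcases le_total v w with h3 | h3
  · rw [min_eq_left h3, max_eq_right h3, hGv, hGw]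
    ring
  · rw [min_eq_right h3, max_eq_left h3, hGv, hGw]
    ring

theorem isEntropyFluxPair_gapEntropy {U : ℝ × ℝ → ℝ} {K : ℝ} (hUm : Measurable U)
    (hU : ∀ p, U p ∈ Icc 0 K) (hG : Continuous G) (hab : a < b) (ha : a ∈ Icc 0 K)
    (hb : b ∈ Icc 0 K) (haff : ∀ x ∈ Icc a b, G x = m * x + q)
    (h : ∀ c ∈ Icc 0 K, IsEntropyFluxPair U (fun v => |v - c|)
      (fun v => G (max v c) - G (min v c))) {w : ℝ} (hw : w ∈ Icc 0 K) :
    IsEntropyFluxPair U (fun v => gapEntropy a b v w) (fun v => gapFlux G a b m v w) := by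
  by_cases hwab : w ∈ Icc a b
  · simp only [gapEntropy_of_mem hwab, gapFlux_of_mem haff hwab]
    exact (h a ha).linear_combination hUm hU (by fun_prop) (by fun_prop) (by fun_prop)
      (by fun_prop) (h b hb) (sub_nonneg.2 hwab.2) (sub_nonneg.2 hwab.1)
  · have := (h w hw).linear_combination hUm hU (by fun_prop) (by fun_prop) (by fun_prop)
      (by fun_prop) (h w hw) (sub_nonneg.2 hab.le) le_rfl
    simpa only [gapEntropy, gapFlux, gapKernel_eq_zero hab hwab, zero_mul, mul_zero] using this

/-- `∂ₜ E(U) + m ∂ₓ E(U) ≤ 0` for `E(v) = gapKernel a b v v`. -/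
theorem integral_gapKernel_self_nonneg {U : ℝ × ℝ → ℝ} {K : ℝ} (hUm : Measurable U)
    (hU : ∀ p, U p ∈ Icc 0 K) {L : NNReal} (hG : LipschitzWith L G) (hab : a < b)
    (ha : a ∈ Icc 0 K) (hb : b ∈ Icc 0 K) (haff : ∀ x ∈ Icc a b, G x = m * x + q)
    (h : ∀ c ∈ Icc 0 K, IsEntropyFluxPair U (fun v => |v - c|)
      (fun v => G (max v c) - G (min v c))) {φ : ℝ × ℝ → ℝ} (hφ : IsTestFunction φ) {δ : ℝ}
    (hδ : 0 < δ) (hφδ : ∀ p, p.2 ≤ δ → φ p = 0) :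
    0 ≤ ∫ p, gapKernel a b (U p) (U p) * (fderiv ℝ φ p (0, 1) + m * fderiv ℝ φ p (1, 0)) := by
  have hC : 0 ≤ (b - a) * (L + |m|) :=
    mul_nonneg (sub_nonneg.2 hab.le) (add_nonneg L.coe_nonneg (abs_nonneg m))
  have hmain := doubling hUm hU continuous_gapEntropy (continuous_gapFlux (m := m) hG.continuous)
    gapEntropy_comm gapFlux_comm (C := (5 + 4 * (L + |m|)) * (b - a))
    (fun u v w => (abs_gapEntropy_sub_le hab u v w).trans
      (mul_le_mul_of_nonneg_right (by linarith) (abs_nonneg _)))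
    (fun u v w => (abs_gapFlux_sub_le hG hab u v w).trans
      (mul_le_mul_of_nonneg_right (by
        have : 0 ≤ (b - a) * L := mul_nonneg (sub_nonneg.2 hab.le) L.coe_nonneg
        linarith) (abs_nonneg _)))
    (fun v hv => isEntropyFluxPair_gapEntropy hUm hU hG.continuous hab ha hb haff h hv) hφ hδ hφδ
  have e : ∀ p, gapEntropy a b (U p) (U p) * fderiv ℝ φ p (0, 1) +
      gapFlux G a b m (U p) (U p) * fderiv ℝ φ p (1, 0) =
      2 * (gapKernel a b (U p) (U p) * (fderiv ℝ φ p (0, 1) + m * fderiv ℝ φ p (1, 0))) := by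
    intro p
    simp only [gapEntropy, gapFlux, sub_self, abs_zero, max_self, min_self]
    ring
  simp only [e, integral_const_mul] at hmain
  linarith

end Gap

theorem deriv_smoothTransition_eq_zero {x : ℝ} (hx : x ∉ Icc (0 : ℝ) 1) :
    deriv Real.smoothTransition x = 0 := by
  rcases lt_or_ge x 0 with h | h
  · refine EventuallyEq.deriv_eq (f := fun _ => 0) ?_ |>.trans (deriv_const _ _)
    filter_upwards [Iio_mem_nhds h] with y hy
    exact Real.smoothTransition.zero_of_nonpos (le_of_lt hy)
  · have h1 : 1 < x := not_le.1 fun h' => hx ⟨h, h'⟩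
    refine EventuallyEq.deriv_eq (f := fun _ => 1) ?_ |>.trans (deriv_const _ _)
    filter_upwards [Ioi_mem_nhds h1] with y hy
    exact Real.smoothTransition.one_of_one_le (le_of_lt hy)

theorem exists_abs_deriv_smoothTransition_le :
    ∃ D, 0 ≤ D ∧ ∀ x, |deriv Real.smoothTransition x| ≤ D := by
  obtain ⟨D, hD⟩ := (isCompact_Icc (a := (0 : ℝ)) (b := 1)).exists_bound_of_continuousOn
    ((Real.smoothTransition.contDiff (n := 1)).continuous_deriv le_rfl).continuousOn
  have hD0 : 0 ≤ D := (norm_nonneg _).trans (hD 0 ⟨le_rfl, zero_le_one⟩)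
  refine ⟨D, hD0, fun x => ?_⟩
  by_cases hx : x ∈ Icc (0 : ℝ) 1
  · exact hD x hx
  · rw [deriv_smoothTransition_eq_zero hx, abs_zero]
    exact hD0

theorem deriv_expNegInvGlue_pos {x : ℝ} (hx : 0 < x) : 0 < deriv expNegInvGlue x := by
  have h : expNegInvGlue =ᶠ[𝓝 x] fun y => Real.exp (-y⁻¹) := by
    filter_upwards [Ioi_mem_nhds hx] with y hy
    simp [expNegInvGlue, not_le.2 (mem_Ioi.1 hy)]
  have hd : HasDerivAt (fun y : ℝ => Real.exp (-y⁻¹)) _ x := (hasDerivAt_inv hx.ne').neg.exp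
  rw [h.deriv_eq, hd.deriv, neg_neg]
  positivity

section Transport

variable {E : ℝ × ℝ → ℝ} {C m : ℝ}

theorem ae_eq_zero_of_transport_of_lt (hEm : Measurable E) (hE0 : ∀ p, 0 ≤ E p)
    (hEC : ∀ p, E p ≤ C)
    (htr : ∀ φ, IsTestFunction φ → ∀ δ > 0, (∀ p : ℝ × ℝ, p.2 ≤ δ → φ p = 0) →
      0 ≤ ∫ p, E p * (fderiv ℝ φ p (0, 1) + m * fderiv ℝ φ p (1, 0)))
    (hinit : ∀ A B : ℝ, Tendsto (fun t => ∫ x in Icc A B, E (x, t)) (𝓝[>] 0) (𝓝 0))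
    {N η : ℝ} (hN : 0 < N) (hη : 0 < η) :
    ∀ᵐ p : ℝ × ℝ, 2 * η ≤ p.2 → p.2 < N → |p.1 - m * p.2| ≤ N → E p = 0 := by
  let χ : ContDiffBump (0 : ℝ) := ⟨N, N + 1, hN, by linarith⟩
  let κ : ℝ → ℝ → ℝ := fun δ t => Real.smoothTransition (t / δ - 1)
  let κ' : ℝ → ℝ → ℝ := fun δ t => deriv Real.smoothTransition (t / δ - 1) / δ
  let g : ℝ → ℝ := fun t => expNegInvGlue (N - t)
  let g' : ℝ → ℝ := fun t => -deriv expNegInvGlue (N - t)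
  have hst : ContDiff ℝ ∞ Real.smoothTransition := Real.smoothTransition.contDiff
  have hgl : ContDiff ℝ ∞ expNegInvGlue := expNegInvGlue.contDiff
  have hκd : ∀ δ t, HasDerivAt (κ δ) (κ' δ t) t := fun δ t => by
    have h1 : HasDerivAt (fun t : ℝ => t / δ - 1) (1 / δ) t :=
      ((hasDerivAt_id t).div_const δ).sub_const 1
    have h2 := (hst.differentiable (by simp) (t / δ - 1)).hasDerivAt.comp t h1
    rwa [mul_one_div] at h2
  have hgd : ∀ t, HasDerivAt g (g' t) t := fun t => by
    have h2 := (hgl.differentiable (by simp) (N - t)).hasDerivAt.comp t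
      ((hasDerivAt_id t).const_sub N)
    rwa [mul_neg_one] at h2
  have hDerivκc : ∀ δ, Continuous (κ' δ) := fun δ =>
    ((hst.continuous_deriv (by simp)).comp (by fun_prop)).div_const δ
  have hDerivgc : Continuous g' := ((hgl.continuous_deriv (by simp)).comp (by fun_prop)).neg
  have hκc : ∀ δ, Continuous (κ δ) := fun δ => hst.continuous.comp (by fun_prop)
  have hgc : Continuous g := hgl.continuous.comp (by fun_prop)
  have hκ0 : ∀ δ > 0, ∀ t ≤ δ, κ δ t = 0 := fun δ hδ t ht =>
    Real.smoothTransition.zero_of_nonpos (sub_nonpos.2 ((div_le_one hδ).2 ht))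
  have hDerivκ0 : ∀ δ > 0, ∀ t ∉ Icc δ (2 * δ), κ' δ t = 0 := fun δ hδ t ht => by
    have : t / δ - 1 ∉ Icc (0 : ℝ) 1 := fun h => ht
      ⟨(one_le_div hδ).1 (sub_nonneg.1 h.1), (div_le_iff₀ hδ).1 (by linarith [h.2])⟩
    simp only [κ', deriv_smoothTransition_eq_zero this, zero_div]
  have hg0 : ∀ t, N ≤ t → g t = 0 := fun t ht => expNegInvGlue.zero_of_nonpos (by linarith)
  have hDerivg0 : ∀ t, N ≤ t → g' t = 0 := fun t ht => by
    have : IsLocalMin g t := Eventually.of_forall fun s => by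
      rw [hg0 t ht]
      exact expNegInvGlue.nonneg _
    exact this.hasDerivAt_eq_zero (hgd t)
  have hDerivg_neg : ∀ t < N, g' t < 0 := fun t ht =>
    neg_neg_of_pos (deriv_expNegInvGlue_pos (sub_pos.2 ht))
  have hDerivg_nonpos : ∀ t, g' t ≤ 0 := fun t => by
    rcases lt_or_ge t N with h | h
    · exact (hDerivg_neg t h).le
    · exact (hDerivg0 t h).le
  set r : ℝ := N + 1 + |m| * N with hr
  -- functions of the form `χ(x - m t) θ(t)` with `θ` supported in `[0, N]`
  have hsupp : ∀ θ : ℝ → ℝ, (∀ t, t ≤ 0 → θ t = 0) → (∀ t, N ≤ t → θ t = 0) →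
      HasCompactSupport fun p : ℝ × ℝ => χ (p.1 - m * p.2) * θ p.2 := by
    intro θ h1 h2
    refine HasCompactSupport.intro ((isCompact_Icc (a := -r) (b := r)).prod
      (isCompact_Icc (a := 0) (b := N))) fun p hp => ?_
    by_cases ht : p.2 ∈ Icc 0 N
    · have hx : p.1 ∉ Icc (-r) r := fun hx => hp ⟨hx, ht⟩
      have : χ (p.1 - m * p.2) = 0 := by
        refine χ.zero_of_le_dist ?_
        rw [dist_zero_right, Real.norm_eq_abs]
        have h3 : r < |p.1| := not_le.1 fun h => hx (abs_le.1 h)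
        have h4 := abs_sub_abs_le_abs_sub p.1 (m * p.2)
        rw [abs_mul, abs_of_nonneg ht.1] at h4
        have h5 := mul_le_mul_of_nonneg_left ht.2 (abs_nonneg m)
        change N + 1 ≤ _
        linarith
      rw [this, zero_mul]
    · have : p.2 ≤ 0 ∨ N ≤ p.2 := by
        by_contra! h
        exact ht ⟨h.1.le, h.2.le⟩
      rcases this with h | h
      · simp only [h1 _ h, mul_zero]
      · simp only [h2 _ h, mul_zero]
  have hInt : ∀ θ : ℝ → ℝ, Continuous θ → (∀ t, t ≤ 0 → θ t = 0) → (∀ t, N ≤ t → θ t = 0) →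
      Integrable fun p : ℝ × ℝ => E p * (χ (p.1 - m * p.2) * θ p.2) := by
    intro θ hθ h1 h2
    refine integrable_mul_of_hasCompactSupport (C := C) hEm
      (fun p => by rw [abs_of_nonneg (hE0 p)]; exact hEC p) ?_ (hsupp θ h1 h2)
    exact (χ.continuous.comp (by fun_prop)).mul (hθ.comp continuous_snd)
  have hIntDerivg : ∀ δ > 0, Integrable fun p : ℝ × ℝ =>
      E p * (χ (p.1 - m * p.2) * (κ δ p.2 * -g' p.2)) := fun δ hδ =>
    hInt (fun t => κ δ t * -g' t) ((hκc δ).mul hDerivgc.neg)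
      (fun t ht => by simp only [hκ0 δ hδ t (ht.trans hδ.le), zero_mul])
      (fun t ht => by simp only [hDerivg0 t ht, neg_zero, mul_zero])
  have hIntDerivκ : ∀ δ > 0, Integrable fun p : ℝ × ℝ =>
      E p * (χ (p.1 - m * p.2) * (κ' δ p.2 * g p.2)) := fun δ hδ =>
    hInt (fun t => κ' δ t * g t) ((hDerivκc δ).mul hgc)
      (fun t ht => by simp only [hDerivκ0 δ hδ t fun h => by linarith [h.1], zero_mul])
      (fun t ht => by simp only [hg0 t ht, mul_zero])
  have hineq : ∀ δ > 0, ∫ p : ℝ × ℝ, E p * (χ (p.1 - m * p.2) * (κ δ p.2 * -g' p.2)) ≤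
      ∫ p : ℝ × ℝ, E p * (χ (p.1 - m * p.2) * (κ' δ p.2 * g p.2)) := by
    intro δ hδ
    let φ : ℝ × ℝ → ℝ := fun p => χ (p.1 - m * p.2) * (κ δ p.2 * g p.2)
    have hφs : ContDiff ℝ ∞ φ := by
      refine (χ.contDiff.comp (by fun_prop)).mul ((hst.comp (by fun_prop)).mul
        (hgl.comp (by fun_prop)))
    have hφ : IsTestFunction φ := by
      refine ⟨hφs, ?_, ?_, ?_⟩
      · exact hsupp (fun t => κ δ t * g t)
          (fun t ht => by simp only [hκ0 δ hδ t (ht.trans hδ.le), zero_mul])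
          (fun t ht => by simp only [hg0 t ht, mul_zero])
      · intro p hp
        simp only [φ, hκ0 δ hδ p.2 (hp.trans hδ.le), zero_mul, mul_zero]
      · exact fun p => mul_nonneg χ.nonneg
          (mul_nonneg (Real.smoothTransition.nonneg _) (expNegInvGlue.nonneg _))
    have hder : ∀ p : ℝ × ℝ, fderiv ℝ φ p (0, 1) + m * fderiv ℝ φ p (1, 0) =
        χ (p.1 - m * p.2) * (κ' δ p.2 * g p.2 + κ δ p.2 * g' p.2) := by
      intro p
      have h1 : fderiv ℝ φ p (0, 1) + m * fderiv ℝ φ p (1, 0) = fderiv ℝ φ p (m, 1) := by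
        have : ((m, 1) : ℝ × ℝ) = (0, 1) + m • (1, 0) := by simp
        rw [this, map_add, map_smul, smul_eq_mul]
      have hcurve : HasDerivAt (fun s : ℝ => (p.1 + m * (s - p.2), s)) ((m, 1) : ℝ × ℝ) p.2 := by
        have hx : HasDerivAt (fun s : ℝ => p.1 + m * (s - p.2)) m p.2 := by
          simpa using (((hasDerivAt_id p.2).sub_const p.2).const_mul m).const_add p.1
        exact hx.prodMk (hasDerivAt_id p.2)
      have h2 : HasDerivAt (fun s : ℝ => φ (p.1 + m * (s - p.2), s)) (fderiv ℝ φ p (m, 1)) p.2 := by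
        refine HasFDerivAt.comp_hasDerivAt (l := φ)
          (f := fun s : ℝ => (p.1 + m * (s - p.2), s)) p.2 ?_ hcurve
        simpa using (hφs.differentiable (by simp) p).hasFDerivAt
      have h3 : (fun s : ℝ => φ (p.1 + m * (s - p.2), s)) =
          fun s => χ (p.1 - m * p.2) * (κ δ s * g s) := by
        funext s
        simp only [φ]
        congr 2
        ring
      rw [h3] at h2
      rw [h1]
      exact h2.unique (((hκd δ p.2).mul (hgd p.2)).const_mul _)
    have h := htr φ hφ δ hδ fun p hp => by simp only [φ, hκ0 δ hδ p.2 hp, zero_mul, mul_zero]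
    simp only [hder] at h
    rw [← sub_nonneg, ← integral_sub (hIntDerivκ δ hδ) (hIntDerivg δ hδ)]
    refine h.trans_eq (integral_congr_ae (Eventually.of_forall fun p => ?_))
    simp only
    ring
  obtain ⟨D, hD0, hD⟩ := exists_abs_deriv_smoothTransition_le
  have hsmall : ∀ ε > 0, ∀ᶠ δ in 𝓝[>] (0 : ℝ),
      ∫ p : ℝ × ℝ, E p * (χ (p.1 - m * p.2) * (κ' δ p.2 * g p.2)) ≤ D * g 0 * ε := by
    intro ε hε
    have hev := (hinit (-r) r).eventually_lt_const hε
    obtain ⟨τ, hτ, hτE⟩ := mem_nhdsGT_iff_exists_Ioo_subset.1 hev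
    have hτ0 : 0 < τ := hτ
    have hpos : 0 < min τ N / 2 := half_pos (lt_min hτ0 hN)
    filter_upwards [Ioo_mem_nhdsGT hpos] with δ hδ
    obtain ⟨hδ, hδ'⟩ := hδ
    have hδτ : 2 * δ < τ := by linarith [min_le_left τ N]
    have hδN : 2 * δ < N := by linarith [min_le_right τ N]
    have hfub : ∫ p : ℝ × ℝ, E p * (χ (p.1 - m * p.2) * (κ' δ p.2 * g p.2)) =
        ∫ t, ∫ x, E (x, t) * (χ (x - m * t) * (κ' δ t * g t)) :=
      integral_prod_symm _ (hIntDerivκ δ hδ)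
    rw [hfub]
    have hinner : ∀ t, ∫ x, E (x, t) * (χ (x - m * t) * (κ' δ t * g t)) =
        κ' δ t * g t * ∫ x, E (x, t) * χ (x - m * t) := fun t => by
      rw [← integral_const_mul]
      congr 1
      funext x
      ring
    simp only [hinner]
    rw [← setIntegral_eq_integral_of_forall_compl_eq_zero (s := Icc δ (2 * δ))
      (fun t ht => by rw [hDerivκ0 δ hδ t ht, zero_mul, zero_mul])]
    have hbound : ∀ t ∈ Icc δ (2 * δ), ‖κ' δ t * g t * ∫ x, E (x, t) * χ (x - m * t)‖ ≤
        D / δ * g 0 * ε := by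
      intro t ht
      have ht0 : 0 < t := hδ.trans_le ht.1
      have htE : ∫ x in Icc (-r) r, E (x, t) < ε := hτE ⟨ht0, ht.2.trans_lt hδτ⟩
      have hEt : IntegrableOn (fun x => E (x, t)) (Icc (-r) r) :=
        Measure.integrableOn_of_bounded (M := C) isCompact_Icc.measure_lt_top.ne
          (hEm.comp measurable_prodMk_right).aestronglyMeasurable
          (Eventually.of_forall fun x => by
            rw [Real.norm_eq_abs, abs_of_nonneg (hE0 _)]
            exact hEC _)
      have h1 : ∫ x, E (x, t) * χ (x - m * t) ≤ ε := by
        refine le_trans ?_ htE.le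
        rw [← integral_indicator measurableSet_Icc]
        refine integral_mono_of_nonneg
          (Eventually.of_forall fun x => mul_nonneg (hE0 _) χ.nonneg)
          ((integrable_indicator_iff measurableSet_Icc).2 hEt) (Eventually.of_forall fun x => ?_)
        by_cases hx : x ∈ Icc (-r) r
        · simp only [indicator_of_mem hx]
          exact mul_le_of_le_one_right (hE0 _) χ.le_one
        · simp only [indicator_of_notMem hx]
          have : χ (x - m * t) = 0 := by
            refine χ.zero_of_le_dist ?_
            rw [dist_zero_right, Real.norm_eq_abs]
            have h3 : r < |x| := not_le.1 fun h => hx (abs_le.1 h)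
            have h4 := abs_sub_abs_le_abs_sub x (m * t)
            rw [abs_mul, abs_of_pos ht0] at h4
            have h5 := mul_le_mul_of_nonneg_left (ht.2.trans hδN.le) (abs_nonneg m)
            change N + 1 ≤ _
            linarith
          rw [this, mul_zero]
      have h2 : 0 ≤ ∫ x, E (x, t) * χ (x - m * t) :=
        integral_nonneg fun x => mul_nonneg (hE0 _) χ.nonneg
      have h3 : |κ' δ t| ≤ D / δ := by
        simp only [κ', abs_div, abs_of_pos hδ]
        exact div_le_div_of_nonneg_right (hD _) hδ.le
      have h4 : g t ≤ g 0 := expNegInvGlue.monotone (by linarith)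
      have h5 : 0 ≤ g t := expNegInvGlue.nonneg _
      rw [Real.norm_eq_abs, abs_mul, abs_mul, abs_of_nonneg h5, abs_of_nonneg h2]
      exact mul_le_mul (mul_le_mul h3 h4 h5 (div_nonneg hD0 hδ.le)) h1 h2
        (mul_nonneg (div_nonneg hD0 hδ.le) (h5.trans h4))
    refine (le_abs_self _).trans ((norm_setIntegral_le_of_norm_le_const
      isCompact_Icc.measure_lt_top hbound).trans_eq ?_)
    rw [measureReal_def, Real.volume_Icc, ENNReal.toReal_ofReal (by linarith)]
    field_simp
    ring
  have hnn : ∀ δ, ∀ p : ℝ × ℝ, 0 ≤ E p * (χ (p.1 - m * p.2) * (κ δ p.2 * -g' p.2)) := fun δ p =>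
    mul_nonneg (hE0 p) (mul_nonneg χ.nonneg (mul_nonneg (Real.smoothTransition.nonneg _)
      (neg_nonneg.2 (hDerivg_nonpos _))))
  have hzero : ∫ p : ℝ × ℝ, E p * (χ (p.1 - m * p.2) * (κ η p.2 * -g' p.2)) = 0 := by
    refine le_antisymm ?_ (integral_nonneg (hnn η))
    refine le_of_forall_pos_le_add fun ε hε => ?_
    have hgD : 0 ≤ D * g 0 := mul_nonneg hD0 (expNegInvGlue.nonneg _)
    obtain ⟨δ, hδs, hδ⟩ := ((hsmall (ε / (D * g 0 + 1)) (by positivity)).and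
      (Ioo_mem_nhdsGT hη)).exists
    have hmono : ∫ p : ℝ × ℝ, E p * (χ (p.1 - m * p.2) * (κ η p.2 * -g' p.2)) ≤
        ∫ p : ℝ × ℝ, E p * (χ (p.1 - m * p.2) * (κ δ p.2 * -g' p.2)) := by
      refine integral_mono (hIntDerivg η hη) (hIntDerivg δ hδ.1) fun p => ?_
      refine mul_le_mul_of_nonneg_left (mul_le_mul_of_nonneg_left
        (mul_le_mul_of_nonneg_right ?_ (neg_nonneg.2 (hDerivg_nonpos _))) χ.nonneg) (hE0 p)
      rcases le_or_gt p.2 0 with h | h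
      · rw [hκ0 η hη _ (h.trans hη.le)]
        exact Real.smoothTransition.nonneg _
      · exact Real.smoothTransition.monotone
          (sub_le_sub_right (div_le_div_of_nonneg_left h.le hδ.1 hδ.2.le) 1)
    have hle : D * g 0 * (ε / (D * g 0 + 1)) ≤ ε := by
      rw [mul_div_assoc', div_le_iff₀ (by positivity)]
      linarith
    linarith [hineq δ hδ.1]
  rw [integral_eq_zero_iff_of_nonneg (hnn η) (hIntDerivg η hη)] at hzero
  filter_upwards [hzero] with p hp h1 h2 h3
  have hχ : χ (p.1 - m * p.2) = 1 := χ.one_of_mem_closedBall (by simpa using h3)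
  have hκ1 : κ η p.2 = 1 := Real.smoothTransition.one_of_one_le (by
    have := (le_div_iff₀ hη).2 h1
    linarith)
  simp only [hχ, hκ1, one_mul, Pi.zero_apply, mul_eq_zero, neg_eq_zero] at hp
  exact hp.resolve_right (hDerivg_neg _ h2).ne

theorem ae_eq_zero_of_transport (hEm : Measurable E) (hE0 : ∀ p, 0 ≤ E p) (hEC : ∀ p, E p ≤ C)
    (htr : ∀ φ, IsTestFunction φ → ∀ δ > 0, (∀ p : ℝ × ℝ, p.2 ≤ δ → φ p = 0) →
      0 ≤ ∫ p, E p * (fderiv ℝ φ p (0, 1) + m * fderiv ℝ φ p (1, 0)))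
    (hinit : ∀ A B : ℝ, Tendsto (fun t => ∫ x in Icc A B, E (x, t)) (𝓝[>] 0) (𝓝 0)) :
    ∀ᵐ p : ℝ × ℝ, 0 < p.2 → E p = 0 := by
  have h : ∀ᵐ p : ℝ × ℝ, ∀ n : ℕ, 2 * (1 / ((n : ℝ) + 1)) ≤ p.2 → p.2 < (n : ℝ) + 1 →
      |p.1 - m * p.2| ≤ (n : ℝ) + 1 → E p = 0 :=
    ae_all_iff.2 fun n => ae_eq_zero_of_transport_of_lt hEm hE0 hEC htr hinit
      (by positivity) (by positivity)
  filter_upwards [h] with p hp h0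
  obtain ⟨n, hn⟩ := exists_nat_gt (max (2 / p.2) (max p.2 |p.1 - m * p.2|))
  simp only [max_lt_iff] at hn
  refine hp n ?_ (by linarith [hn.2.1]) (by linarith [hn.2.2])
  rw [mul_one_div, div_le_iff₀ (by positivity)]
  have := (div_lt_iff₀ h0).1 hn.1
  linarith

end Transport

theorem exists_maximal_gap {K : ℝ} {R : Set ℝ} (hR : IsClosed R) (hRsub : R ⊆ Icc 0 K)
    (h0 : (0 : ℝ) ∈ R) (hK : K ∈ R) {v : ℝ} (hv : v ∈ Icc 0 K) (hvR : v ∉ R) :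
    ∃ a b, a ∈ R ∧ b ∈ R ∧ a < v ∧ v < b ∧ Ioo a b ∩ R = ∅ := by
  have hA : IsCompact (R ∩ Icc 0 v) := isCompact_Icc.inter_left hR
  have hB : IsCompact (R ∩ Icc v K) := isCompact_Icc.inter_left hR
  obtain ⟨a, ha, hamax⟩ := hA.exists_isGreatest ⟨0, h0, le_rfl, hv.1⟩
  obtain ⟨b, hb, hbmin⟩ := hB.exists_isLeast ⟨K, hK, hv.2, le_rfl⟩
  refine ⟨a, b, ha.1, hb.1, lt_of_le_of_ne ha.2.2 (fun h => hvR (h ▸ ha.1)),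
    lt_of_le_of_ne hb.2.1 (fun h => hvR (h ▸ hb.1)), ?_⟩
  ext x
  simp only [mem_inter_iff, mem_Ioo, mem_empty_iff_false, iff_false, not_and]
  rintro ⟨hax, hxb⟩ hxR
  rcases le_total x v with h | h
  · exact absurd (hamax ⟨hxR, (hRsub hxR).1, h⟩) (not_le.2 hax)
  · exact absurd (hbmin ⟨hxR, h, (hRsub hxR).2⟩) (not_le.2 hxb)

theorem gapKernel_self_eq_zero {a b v : ℝ} (hab : a < b) (hv : v ∉ Ioo a b) :
    gapKernel a b v v = 0 := by
  rw [gapKernel_self]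
  rcases le_or_gt v a with h | h
  · rw [max_eq_left ((min_le_right _ _).trans h), sub_self, zero_mul]
  · have hb : b ≤ v := not_lt.1 fun h' => hv ⟨h, h'⟩
    rw [min_eq_left hb, max_eq_right hab.le, sub_self, mul_zero]

theorem ae_notMem_gap {K : ℝ} {R : Set ℝ} (hRsub : R ⊆ Icc 0 K) {G : ℝ → ℝ} {L : NNReal}
    (hG : LipschitzWith L G) {u : ℝ → ℝ → ℝ} (hmeas : Measurable fun p : ℝ × ℝ => u p.1 p.2)
    (hrange : ∀ x t : ℝ, u x t ∈ Icc 0 K) (hent : IsEntropySolution K G u) {u₀ : ℝ → ℝ}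
    (hu₀meas : Measurable u₀) (hu₀range : ∀ x, u₀ x ∈ Icc 0 K) (hu₀R : ∀ᵐ x : ℝ, u₀ x ∈ R)
    (hinit : ∀ A B : ℝ, Tendsto (fun t => ∫ x in Icc A B, |u x t - u₀ x|) (𝓝[>] 0) (𝓝 0))
    {a b m q : ℝ} (ha : a ∈ R) (hb : b ∈ R) (hab : a < b) (hgap : Ioo a b ∩ R = ∅)
    (haff : ∀ x ∈ Icc a b, G x = m * x + q) :
    ∀ᵐ p : ℝ × ℝ, 0 < p.2 → u p.1 p.2 ∉ Ioo a b := by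
  have hclamp : ∀ v, a ≤ max a (min b v) ∧ max a (min b v) ≤ b := fun v =>
    ⟨le_max_left _ _, max_le hab.le (min_le_left _ _)⟩
  have hcont : Continuous fun v => gapKernel a b v v :=
    continuous_gapKernel.comp (continuous_id.prodMk continuous_id)
  have hE0 : ∀ v, 0 ≤ gapKernel a b v v := fun v => by
    rw [gapKernel_self]
    exact mul_nonneg (sub_nonneg.2 (hclamp v).1) (sub_nonneg.2 (hclamp v).2)
  have hEC : ∀ v, gapKernel a b v v ≤ (b - a) * (b - a) := fun v => by
    rw [gapKernel_self]
    exact mul_le_mul (by linarith [(hclamp v).2]) (by linarith [(hclamp v).1])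
      (sub_nonneg.2 (hclamp v).2) (sub_nonneg.2 hab.le)
  have hlip : ∀ v w, gapKernel a b v v ≤ gapKernel a b w w + 4 * (b - a) * |v - w| := by
    intro v w
    have h1 := le_abs_self (gapKernel a b v v - gapKernel a b v w)
    have h2 := le_abs_self (gapKernel a b w v - gapKernel a b w w)
    have h3 := abs_gapKernel_sub_le hab v v w
    have h4 := abs_gapKernel_sub_le hab w v w
    rw [gapKernel_comm w v] at h2 h4
    linarith
  have hutm : ∀ t, Measurable fun x => u x t := fun t => hmeas.comp measurable_prodMk_right
  have hEinit : ∀ A B : ℝ, Tendsto (fun t => ∫ x in Icc A B, gapKernel a b (u x t) (u x t))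
      (𝓝[>] 0) (𝓝 0) := by
    intro A B
    have hlim := (hinit A B).const_mul (4 * (b - a))
    rw [mul_zero] at hlim
    refine squeeze_zero (fun t => integral_nonneg fun x => hE0 _) (fun t => ?_) hlim
    rw [← integral_const_mul]
    have hi : IntegrableOn (fun x => |u x t - u₀ x|) (Icc A B) :=
      Measure.integrableOn_of_bounded (M := K) isCompact_Icc.measure_lt_top.ne
        ((hutm t).sub hu₀meas).norm.aestronglyMeasurable
        (Eventually.of_forall fun x => by
          rw [Real.norm_eq_abs, abs_abs, abs_le]
          constructor <;> linarith [(hrange x t).1, (hrange x t).2, (hu₀range x).1, (hu₀range x).2])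
    refine integral_mono_of_nonneg (Eventually.of_forall fun x => hE0 _) (hi.const_mul _) ?_
    filter_upwards [ae_restrict_of_ae hu₀R] with x hx
    have hz : gapKernel a b (u₀ x) (u₀ x) = 0 :=
      gapKernel_self_eq_zero hab fun h => eq_empty_iff_forall_notMem.1 hgap (u₀ x) ⟨h, hx⟩
    have := hlip (u x t) (u₀ x)
    rwa [hz, zero_add] at this
  have hzero := ae_eq_zero_of_transport (E := fun p => gapKernel a b (u p.1 p.2) (u p.1 p.2))
    (m := m) (hcont.measurable.comp hmeas) (fun p => hE0 _) (fun p => hEC _)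
    (fun φ hφ δ hδ hφδ => integral_gapKernel_self_nonneg hmeas (fun p => hrange p.1 p.2) hG hab
      (hRsub ha) (hRsub hb) haff
      (fun c hc => hent.isEntropyFluxPair hG.continuous hmeas hrange hc) hφ hδ hφδ) hEinit
  filter_upwards [hzero] with p hp h0 hmem
  have h := hp h0
  rw [gapKernel_self, min_eq_right hmem.2.le, max_eq_right hmem.1.le] at h
  exact (mul_pos (sub_pos.2 hmem.1) (sub_pos.2 hmem.2)).ne' h

/-- Lemma 5.3: an entropy solution whose initial datum is a.e. `R`-valued remains a.e.
`R`-valued for all positive times. -/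
theorem entropy_solution_stays_R_valued (K : ℝ) (hK : 0 < K)
    (R : Set ℝ) (hRclosed : IsClosed R) (hRsub : R ⊆ Set.Icc 0 K)
    (h0R : (0 : ℝ) ∈ R) (hKR : K ∈ R)
    (G : ℝ → ℝ) (L : NNReal) (hG : LipschitzOnWith L G (Set.Icc 0 K))
    (haff : AffineOnGaps R G)
    (u : ℝ → ℝ → ℝ) (hmeas : Measurable fun p : ℝ × ℝ => u p.1 p.2)
    (hrange : ∀ x t : ℝ, u x t ∈ Set.Icc 0 K)
    (hent : IsEntropySolution K G u)
    (u₀ : ℝ → ℝ) (hu₀meas : Measurable u₀) (hu₀range : ∀ x, u₀ x ∈ Set.Icc 0 K)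
    (hu₀R : ∀ᵐ x : ℝ, u₀ x ∈ R)
    (hinit : ∀ A B : ℝ, Filter.Tendsto
      (fun t => ∫ x in Set.Icc A B, |u x t - u₀ x|)
      (nhdsWithin 0 (Set.Ioi 0)) (nhds 0)) :
    ∀ᵐ p : ℝ × ℝ, 0 < p.2 → u p.1 p.2 ∈ R := by
  obtain ⟨G', hG', hGG'⟩ := hG.extend_real
  have hent' : IsEntropySolution K G' u := by
    intro c hc φ h1 h2 h3 h4
    have h := hent c hc φ h1 h2 h3 h4
    simpa only [hGG' hc, fun x t => hGG' (hrange x t)] using h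
  have hall : ∀ᵐ p : ℝ × ℝ, ∀ s : ℚ, ∀ a b : ℝ, a ∈ R → b ∈ R → a < s → s < b →
      Ioo a b ∩ R = ∅ → 0 < p.2 → u p.1 p.2 ∉ Ioo a b := by
    refine ae_all_iff.2 fun s => ?_
    by_cases hs : ∃ a b : ℝ, a ∈ R ∧ b ∈ R ∧ a < s ∧ s < b ∧ Ioo a b ∩ R = ∅
    · obtain ⟨a, b, ha, hb, has, hsb, hgap⟩ := hs
      obtain ⟨m, q, hmq⟩ := haff a b ha hb (has.trans hsb) hgap
      have hmq' : ∀ x ∈ Icc a b, G' x = m * x + q := fun x hx => by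
        rw [← hGG' ⟨(hRsub ha).1.trans hx.1, hx.2.trans (hRsub hb).2⟩, hmq x hx]
      filter_upwards [ae_notMem_gap hRsub hG' hmeas hrange hent' hu₀meas hu₀range hu₀R hinit
        ha hb (has.trans hsb) hgap hmq'] with p hp a' b' ha' hb' has' hsb' hgap' h0 hmem
      refine hp h0 ⟨lt_of_le_of_lt ?_ hmem.1, lt_of_lt_of_le hmem.2 ?_⟩
      · by_contra! h
        exact notMem_empty a (hgap' ▸ ⟨⟨h, has.trans hsb'⟩, ha⟩)
      · by_contra! h
        exact notMem_empty b (hgap' ▸ ⟨⟨has'.trans hsb, h⟩, hb⟩)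
    · exact Eventually.of_forall fun p a b ha hb has hsb hgap =>
        absurd ⟨a, b, ha, hb, has, hsb, hgap⟩ hs
  filter_upwards [hall] with p hp h0
  by_contra hv
  obtain ⟨a, b, ha, hb, hav, hvb, hgap⟩ :=
    exists_maximal_gap hRclosed hRsub h0R hKR (hrange p.1 p.2) hv
  obtain ⟨s, hs1, hs2⟩ := exists_rat_btwn hav
  exact hp s a b ha hb hs1 (hs2.trans hvb) hgap h0 ⟨hav, hvb⟩
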